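/- Let R be a commutative ring and (H,A,C) a right-right Doi-Koppinen structure, i.e. H an R-bialgebra, A a right H-comodule algebra with coaction ρ_A(a) = Σ a_{⟨0⟩}⊗a_{⟨1⟩}, and C a right H-module coalgebra. Then the map ψ : C⊗_R A → A⊗_R C, ψ(c⊗a) := Σ a_{⟨0⟩} ⊗ c·a_{⟨1⟩}, satisfies the four axioms of a right-right entwining structure: Σ (ab)_ψ ⊗ c^ψ = Σ a_ψ b_Ψ ⊗ c^{ψΨ}; Σ (1_A)_ψ ⊗ c^ψ = 1_A ⊗ c; Σ a_ψ ⊗ Δ_C(c^ψ) = Σ a_{ψΨ} ⊗ c_1^Ψ ⊗ c_2^ψ; and Σ ε_C(c^ψ) a_ψ = ε_C(c) a, where Σ a_ψ⊗c^ψ := ψ(c⊗a). Consequently, the Koppinen smash product #^op(C,A) = Hom_R(C,A) with multiplication (f·g)(c) = Σ f(c_2)_{⟨0⟩} · g(c_1·f(c_2)_{⟨1⟩}) and unit η_A∘ε_C is an associative unital R-algebra. -/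

import Mathlib

open TensorProduct

/-- The four axioms of a right-right entwining structure `(A, C, ψ)`:
`Σ (ab)_ψ ⊗ c^ψ = Σ a_ψ b_Ψ ⊗ c^{ψΨ}`, `Σ (1_A)_ψ ⊗ c^ψ = 1_A ⊗ c`,
`Σ a_ψ ⊗ Δ(c^ψ) = Σ a_{ψΨ} ⊗ c_1^Ψ ⊗ c_2^ψ` and `Σ ε(c^ψ) a_ψ = ε(c) a`,
expressed as equalities of linear maps. -/
structure IsEntwining (R A C : Type*) [CommRing R] [Ring A] [Algebra R A]
    [AddCommGroup C] [Module R C] [Coalgebra R C]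
    (ψ : C ⊗[R] A →ₗ[R] A ⊗[R] C) : Prop where
  mul_compat :
    ψ ∘ₗ TensorProduct.map LinearMap.id (LinearMap.mul' R A) ∘ₗ
        (TensorProduct.assoc R C A A).toLinearMap
      = TensorProduct.map (LinearMap.mul' R A) LinearMap.id ∘ₗ
        (TensorProduct.assoc R A A C).symm.toLinearMap ∘ₗ
        TensorProduct.map LinearMap.id ψ ∘ₗ
        (TensorProduct.assoc R A C A).toLinearMap ∘ₗ
        TensorProduct.map ψ LinearMap.id
  one_compat : ∀ c : C, ψ (c ⊗ₜ[R] (1 : A)) = (1 : A) ⊗ₜ[R] c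
  comul_compat :
    TensorProduct.map LinearMap.id Coalgebra.comul ∘ₗ ψ
      = (TensorProduct.assoc R A C C).toLinearMap ∘ₗ
        TensorProduct.map ψ LinearMap.id ∘ₗ
        (TensorProduct.assoc R C A C).symm.toLinearMap ∘ₗ
        TensorProduct.map LinearMap.id ψ ∘ₗ
        (TensorProduct.assoc R C C A).toLinearMap ∘ₗ
        TensorProduct.map Coalgebra.comul LinearMap.id
  counit_compat :
    (TensorProduct.rid R A).toLinearMap ∘ₗ
        TensorProduct.map LinearMap.id Coalgebra.counit ∘ₗ ψ
      = (TensorProduct.lid R A).toLinearMap ∘ₗ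
        TensorProduct.map Coalgebra.counit LinearMap.id

variable (R : Type*) {A C : Type*} [CommRing R] [Ring A] [Algebra R A]
  [AddCommGroup C] [Module R C] [Coalgebra R C]

/-- The multiplication `(f·g)(c) = Σ f(c_2)_ψ g(c_1^ψ)` on `Hom_R(C,A)`. -/
noncomputable def smashMul (ψ : C ⊗[R] A →ₗ[R] A ⊗[R] C) (f g : C →ₗ[R] A) :
    C →ₗ[R] A :=
  LinearMap.mul' R A ∘ₗ TensorProduct.map LinearMap.id g ∘ₗ ψ ∘ₗ
    TensorProduct.map LinearMap.id f ∘ₗ Coalgebra.comul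

/-- The unit `η_A ∘ ε_C` of `Hom_R(C,A)`. -/
noncomputable def smashOne : C →ₗ[R] A :=
  Algebra.linearMap R A ∘ₗ Coalgebra.counit

/-- The left `A`-operation `(a·f)(c) = Σ a_ψ f(c^ψ)` on `Hom_R(C,A)`. -/
noncomputable def smashLAct (ψ : C ⊗[R] A →ₗ[R] A ⊗[R] C) (a : A) (f : C →ₗ[R] A) :
    C →ₗ[R] A :=
  LinearMap.mul' R A ∘ₗ TensorProduct.map LinearMap.id f ∘ₗ ψ ∘ₗ
    (TensorProduct.mk R C A).flip a

/-- The right `A`-operation `(f·a)(c) = f(c)a` on `Hom_R(C,A)`. -/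
noncomputable def smashRAct (a : A) (f : C →ₗ[R] A) : C →ₗ[R] A :=
  LinearMap.mulRight R a ∘ₗ f

/-- The entwining map `ψ : C ⊗ A → A ⊗ C`, `c ⊗ a ↦ Σ a_{⟨0⟩} ⊗ c·a_{⟨1⟩}`,
associated to a right-right Doi-Koppinen structure `(H,A,C)`. -/
noncomputable def doiKoppinenPsi {R H A C : Type*} [CommRing R]
    [AddCommGroup H] [Module R H] [Ring A] [Algebra R A]
    [AddCommGroup C] [Module R C]
    (ρ : A →ₗ[R] A ⊗[R] H) (act : C →ₗ[R] H →ₗ[R] C) :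
    C ⊗[R] A →ₗ[R] A ⊗[R] C :=
  TensorProduct.map LinearMap.id (TensorProduct.lift act) ∘ₗ
    (TensorProduct.leftComm R C A H).toLinearMap ∘ₗ
    TensorProduct.map LinearMap.id ρ

namespace IsEntwining

variable {R A C : Type*} [CommRing R] [Ring A] [Algebra R A]
  [AddCommGroup C] [Module R C] [Coalgebra R C] {ψ : C ⊗[R] A →ₗ[R] A ⊗[R] C}

/-- The map `a ⊗ (c ⊗ d) ↦ Σ a g(d)_ψ h(c^ψ)`, through which both bracketings of a triple smash
product factor. -/
noncomputable def tripleMul (ψ : C ⊗[R] A →ₗ[R] A ⊗[R] C) (g h : C →ₗ[R] A) :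
    A ⊗[R] (C ⊗[R] C) →ₗ[R] A :=
  LinearMap.mul' R A ∘ₗ TensorProduct.map LinearMap.id
    (LinearMap.mul' R A ∘ₗ TensorProduct.map LinearMap.id h ∘ₗ ψ ∘ₗ
      TensorProduct.map LinearMap.id g)

theorem mul'_psi_tmul_mul' (hψ : IsEntwining R A C ψ) (g h : C →ₗ[R] A) (c : C)
    (z : A ⊗[R] C) :
    LinearMap.mul' R A (TensorProduct.map LinearMap.id h
        (ψ (c ⊗ₜ[R] LinearMap.mul' R A (TensorProduct.map LinearMap.id g z))))
      = tripleMul ψ g h (TensorProduct.assoc R A C C (TensorProduct.map ψ LinearMap.id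
          ((TensorProduct.assoc R C A C).symm (c ⊗ₜ[R] z)))) := by
  induction z with
  | zero => simp
  | add x y hx hy => simp only [map_add, TensorProduct.tmul_add, hx, hy]
  | tmul b d =>
    have hmul := LinearMap.congr_fun hψ.mul_compat ((c ⊗ₜ[R] b) ⊗ₜ[R] g d)
    simp only [LinearMap.comp_apply, LinearEquiv.coe_coe, TensorProduct.assoc_tmul,
      TensorProduct.map_tmul, LinearMap.id_apply, LinearMap.mul'_apply] at hmul
    simp only [TensorProduct.map_tmul, LinearMap.id_apply, LinearMap.mul'_apply, hmul,
      TensorProduct.assoc_symm_tmul]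
    induction ψ (c ⊗ₜ[R] b) with
    | zero => simp
    | add x y hx hy => simp only [map_add, TensorProduct.add_tmul, hx, hy]
    | tmul a e =>
      simp only [tripleMul, LinearMap.comp_apply, TensorProduct.assoc_tmul,
        TensorProduct.map_tmul, LinearMap.id_apply, LinearMap.mul'_apply]
      induction ψ (e ⊗ₜ[R] g d) with
      | zero => simp
      | add x y hx hy => simp only [map_add, TensorProduct.tmul_add, mul_add, hx, hy]
      | tmul p q => simp [mul_assoc]

theorem smashMul_assoc (hψ : IsEntwining R A C ψ) (f g h : C →ₗ[R] A) :
    smashMul R ψ (smashMul R ψ f g) h = smashMul R ψ f (smashMul R ψ g h) := by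
  set m := LinearMap.mul' R A with hm
  have hleft (z : C ⊗[R] C) :
      m (TensorProduct.map LinearMap.id h (ψ
          (TensorProduct.map LinearMap.id (smashMul R ψ f g) z)))
        = m (TensorProduct.map LinearMap.id h (ψ (TensorProduct.map LinearMap.id
            (m ∘ₗ TensorProduct.map LinearMap.id g ∘ₗ ψ ∘ₗ TensorProduct.map LinearMap.id f)
            (TensorProduct.map LinearMap.id Coalgebra.comul z)))) := by
    induction z with
    | zero => simp
    | add x y hx hy => simp only [map_add, hx, hy]
    | tmul c d => rfl
  have hright (z : A ⊗[R] C) :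
      m (TensorProduct.map LinearMap.id (smashMul R ψ g h) z)
        = tripleMul ψ g h (TensorProduct.map LinearMap.id Coalgebra.comul z) := by
    induction z with
    | zero => simp
    | add x y hx hy => simp only [map_add, hx, hy]
    | tmul c d => rfl
  have hbracket (e : C ⊗[R] C) (d : C) :
      m (TensorProduct.map LinearMap.id h (ψ (TensorProduct.map LinearMap.id
            (m ∘ₗ TensorProduct.map LinearMap.id g ∘ₗ ψ ∘ₗ TensorProduct.map LinearMap.id f)
            (TensorProduct.assoc R C C C (e ⊗ₜ[R] d)))))
        = tripleMul ψ g h (TensorProduct.assoc R A C C (TensorProduct.map ψ LinearMap.id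
          ((TensorProduct.assoc R C A C).symm (TensorProduct.map LinearMap.id ψ
            (TensorProduct.assoc R C C A (e ⊗ₜ[R] f d)))))) := by
    induction e with
    | zero => simp
    | add x y hx hy => simp only [map_add, TensorProduct.add_tmul, hx, hy]
    | tmul p q =>
      simpa using hψ.mul'_psi_tmul_mul' g h p (ψ (q ⊗ₜ[R] f d))
  have hcomul (z : C ⊗[R] C) :
      m (TensorProduct.map LinearMap.id h (ψ (TensorProduct.map LinearMap.id
            (m ∘ₗ TensorProduct.map LinearMap.id g ∘ₗ ψ ∘ₗ TensorProduct.map LinearMap.id f)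
            (TensorProduct.assoc R C C C (TensorProduct.map Coalgebra.comul LinearMap.id z)))))
        = tripleMul ψ g h (TensorProduct.map LinearMap.id Coalgebra.comul
            (ψ (TensorProduct.map LinearMap.id f z))) := by
    induction z with
    | zero => simp
    | add x y hx hy => simp only [map_add, hx, hy]
    | tmul c d =>
      have hc := LinearMap.congr_fun hψ.comul_compat (c ⊗ₜ[R] f d)
      simp only [LinearMap.comp_apply, LinearEquiv.coe_coe, TensorProduct.map_tmul,
        LinearMap.id_apply] at hc
      simp only [TensorProduct.map_tmul, LinearMap.id_apply, hc, hbracket]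
  ext c
  have hcoassoc : TensorProduct.assoc R C C C
      (TensorProduct.map Coalgebra.comul LinearMap.id (Coalgebra.comul (R := R) c))
        = TensorProduct.map LinearMap.id Coalgebra.comul (Coalgebra.comul (R := R) c) :=
    Coalgebra.coassoc_apply c
  calc
    _ = m (TensorProduct.map LinearMap.id h (ψ
          (TensorProduct.map LinearMap.id (smashMul R ψ f g) (Coalgebra.comul (R := R) c)))) := rfl
    _ = m (TensorProduct.map LinearMap.id (smashMul R ψ g h)
          (ψ (TensorProduct.map LinearMap.id f (Coalgebra.comul (R := R) c)))) := by
      rw [hleft, ← hcoassoc, hcomul, ← hright]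
    _ = _ := rfl

theorem smashOne_smashMul (hψ : IsEntwining R A C ψ) (f : C →ₗ[R] A) :
    smashMul R ψ (smashOne R) f = f := by
  have key (z : C ⊗[R] C) :
      LinearMap.mul' R A (TensorProduct.map LinearMap.id f
          (ψ (TensorProduct.map LinearMap.id (smashOne R) z)))
        = f (TensorProduct.rid R C (TensorProduct.map LinearMap.id Coalgebra.counit z)) := by
    induction z with
    | zero => simp
    | add x y hx hy => simp only [map_add, hx, hy]
    | tmul c d =>
      simp [smashOne, Algebra.algebraMap_eq_smul_one, hψ.one_compat]
  ext c
  refine (key _).trans ?_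
  have hcounit : TensorProduct.map LinearMap.id Coalgebra.counit (Coalgebra.comul (R := R) c)
      = c ⊗ₜ[R] (1 : R) := Coalgebra.lTensor_counit_comul c
  simp [hcounit]

theorem smashMul_smashOne (hψ : IsEntwining R A C ψ) (f : C →ₗ[R] A) :
    smashMul R ψ f (smashOne R) = f := by
  have hone (z : A ⊗[R] C) :
      LinearMap.mul' R A (TensorProduct.map LinearMap.id (smashOne R) z)
        = TensorProduct.rid R A (TensorProduct.map LinearMap.id Coalgebra.counit z) := by
    induction z with
    | zero => simp
    | add x y hx hy => simp only [map_add, hx, hy]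
    | tmul a c => simp [smashOne, Algebra.algebraMap_eq_smul_one]
  have key (z : C ⊗[R] C) :
      LinearMap.mul' R A (TensorProduct.map LinearMap.id (smashOne R)
          (ψ (TensorProduct.map LinearMap.id f z)))
        = f (TensorProduct.lid R C (TensorProduct.map Coalgebra.counit LinearMap.id z)) := by
    induction z with
    | zero => simp
    | add x y hx hy => simp only [map_add, hx, hy]
    | tmul c d =>
      have hc := LinearMap.congr_fun hψ.counit_compat (c ⊗ₜ[R] f d)
      simp only [LinearMap.comp_apply, LinearEquiv.coe_coe, TensorProduct.map_tmul,
        LinearMap.id_apply, TensorProduct.lid_tmul] at hc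
      simp [hone, hc]
  ext c
  refine (key _).trans ?_
  have hcounit : TensorProduct.map Coalgebra.counit LinearMap.id (Coalgebra.comul (R := R) c)
      = (1 : R) ⊗ₜ[R] c := Coalgebra.rTensor_counit_comul c
  simp [hcounit]

end IsEntwining

section DoiKoppinen

variable {R H A C : Type*} [CommRing R]

theorem doiKoppinenPsi_tmul [AddCommGroup H] [Module R H] [Ring A] [Algebra R A]
    [AddCommGroup C] [Module R C]
    (ρ : A →ₗ[R] A ⊗[R] H) (act : C →ₗ[R] H →ₗ[R] C) (c : C) (a : A) :
    doiKoppinenPsi ρ act (c ⊗ₜ[R] a) = TensorProduct.map LinearMap.id (act c) (ρ a) := by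
  simp only [doiKoppinenPsi, LinearMap.comp_apply, TensorProduct.map_tmul, LinearMap.id_apply,
    LinearEquiv.coe_coe]
  induction ρ a with
  | zero => simp
  | add x y hx hy => simp only [map_add, TensorProduct.tmul_add, hx, hy]
  | tmul b h => simp

variable [Ring H] [Bialgebra R H] [Ring A] [Algebra R A] [AddCommGroup C] [Module R C]

theorem doiKoppinenPsi_mul (ρ : A →ₗ[R] A ⊗[R] H) (act : C →ₗ[R] H →ₗ[R] C)
    (hρmul : ∀ a b : A, ρ (a * b) = ρ a * ρ b)
    (hact_mul : ∀ (c : C) (h k : H), act (act c h) k = act c (h * k)) (c : C) (a b : A) :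
    doiKoppinenPsi ρ act (c ⊗ₜ[R] (a * b))
      = TensorProduct.map (LinearMap.mul' R A) LinearMap.id
          ((TensorProduct.assoc R A A C).symm (TensorProduct.map LinearMap.id
            (doiKoppinenPsi ρ act) (TensorProduct.assoc R A C A
              (doiKoppinenPsi ρ act (c ⊗ₜ[R] a) ⊗ₜ[R] b)))) := by
  rw [doiKoppinenPsi_tmul, doiKoppinenPsi_tmul, hρmul]
  induction ρ a with
  | zero => simp
  | add x y hx hy => simp only [map_add, TensorProduct.add_tmul, add_mul, hx, hy]
  | tmul a₀ h =>
    simp only [TensorProduct.map_tmul, TensorProduct.assoc_tmul, doiKoppinenPsi_tmul,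
      LinearMap.id_apply]
    induction ρ b with
    | zero => simp
    | add x y hx hy => simp only [map_add, TensorProduct.tmul_add, mul_add, hx, hy]
    | tmul b₀ k => simp [hact_mul]

variable [Coalgebra R C]

theorem map_comul_doiKoppinenPsi (ρ : A →ₗ[R] A ⊗[R] H) (act : C →ₗ[R] H →ₗ[R] C)
    (hcoassoc : TensorProduct.map LinearMap.id Coalgebra.comul ∘ₗ ρ
      = (TensorProduct.assoc R A H H).toLinearMap ∘ₗ TensorProduct.map ρ LinearMap.id ∘ₗ ρ)
    (hΔ : ∀ (c : C) (h : H),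
        Coalgebra.comul (act c h)
          = TensorProduct.map (TensorProduct.lift act) (TensorProduct.lift act)
              (TensorProduct.tensorTensorTensorComm R C C H H
                (Coalgebra.comul c ⊗ₜ[R] Coalgebra.comul h))) (c : C) (a : A) :
    TensorProduct.map LinearMap.id Coalgebra.comul (doiKoppinenPsi ρ act (c ⊗ₜ[R] a))
      = TensorProduct.assoc R A C C (TensorProduct.map (doiKoppinenPsi ρ act) LinearMap.id
          ((TensorProduct.assoc R C A C).symm (TensorProduct.map LinearMap.id
            (doiKoppinenPsi ρ act) (TensorProduct.assoc R C C A
              (Coalgebra.comul c ⊗ₜ[R] a))))) := by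
  have hleft (x : A ⊗[R] H) :
      TensorProduct.map LinearMap.id Coalgebra.comul (TensorProduct.map LinearMap.id (act c) x)
        = TensorProduct.map LinearMap.id
            (TensorProduct.map (TensorProduct.lift act) (TensorProduct.lift act) ∘ₗ
              (TensorProduct.tensorTensorTensorComm R C C H H).toLinearMap ∘ₗ
              TensorProduct.mk R (C ⊗[R] C) (H ⊗[R] H) (Coalgebra.comul c))
            (TensorProduct.map LinearMap.id Coalgebra.comul x) := by
    induction x with
    | zero => simp
    | add x y hx hy => simp only [map_add, hx, hy]
    | tmul b h => simp [hΔ]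
  have hρ : TensorProduct.map LinearMap.id Coalgebra.comul (ρ a)
      = TensorProduct.assoc R A H H (TensorProduct.map ρ LinearMap.id (ρ a)) :=
    LinearMap.congr_fun hcoassoc a
  rw [doiKoppinenPsi_tmul, hleft, hρ]
  induction Coalgebra.comul (R := R) c with
  | zero => simp
  | add x y hx hy =>
    simp only [map_add, TensorProduct.add_tmul, LinearMap.comp_add, TensorProduct.map_add_right,
      LinearMap.add_apply, hx, hy]
  | tmul p q =>
    simp only [TensorProduct.assoc_tmul, TensorProduct.map_tmul, doiKoppinenPsi_tmul,
      LinearMap.id_apply]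
    induction ρ a with
    | zero => simp
    | add x y hx hy => simp only [map_add, TensorProduct.tmul_add, hx, hy]
    | tmul b h =>
      simp only [TensorProduct.assoc_symm_tmul, TensorProduct.map_tmul, doiKoppinenPsi_tmul,
        LinearMap.id_apply]
      induction ρ b with
      | zero => simp
      | add x y hx hy => simp only [map_add, TensorProduct.add_tmul, hx, hy]
      | tmul b₀ k => simp

theorem rid_map_counit_doiKoppinenPsi (ρ : A →ₗ[R] A ⊗[R] H) (act : C →ₗ[R] H →ₗ[R] C)
    (hcounit : ∀ a : A,
      (TensorProduct.rid R A) (TensorProduct.map LinearMap.id Coalgebra.counit (ρ a)) = a)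
    (hε : ∀ (c : C) (h : H),
        Coalgebra.counit (act c h)
          = Coalgebra.counit (R := R) c * Coalgebra.counit (R := R) h) (c : C) (a : A) :
    TensorProduct.rid R A (TensorProduct.map LinearMap.id Coalgebra.counit
        (doiKoppinenPsi ρ act (c ⊗ₜ[R] a))) = Coalgebra.counit (R := R) c • a := by
  rw [doiKoppinenPsi_tmul]
  conv_rhs => rw [← hcounit a]
  induction ρ a with
  | zero => simp
  | add x y hx hy => simp only [map_add, smul_add, hx, hy]
  | tmul b h => simp [hε, mul_smul]

end DoiKoppinen

/-- For a right-right Doi-Koppinen structure `(H,A,C)` (an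
`R`-bialgebra `H`, a right `H`-comodule algebra `A` and a right `H`-module coalgebra
`C`), the map `ψ(c ⊗ a) = Σ a_{⟨0⟩} ⊗ c·a_{⟨1⟩}` is a right-right entwining
structure, and consequently the Koppinen smash product `#^op(C,A) = Hom_R(C,A)` with
`(f·g)(c) = Σ f(c_2)_{⟨0⟩} g(c_1·f(c_2)_{⟨1⟩})` and unit `η_A ∘ ε_C` is an
associative unital `R`-algebra. -/
theorem doi_koppinen_entwining_and_koppinen_smash
    {R H A C : Type*} [CommRing R] [Ring H] [Bialgebra R H]
    [Ring A] [Algebra R A] [AddCommGroup C] [Module R C] [Coalgebra R C]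
    -- `A` is a right `H`-comodule algebra:
    (ρ : A →ₗ[R] A ⊗[R] H)
    (hcoassoc : TensorProduct.map LinearMap.id Coalgebra.comul ∘ₗ ρ
      = (TensorProduct.assoc R A H H).toLinearMap ∘ₗ TensorProduct.map ρ LinearMap.id ∘ₗ ρ)
    (hcounit : ∀ a : A,
      (TensorProduct.rid R A) (TensorProduct.map LinearMap.id Coalgebra.counit (ρ a)) = a)
    (hρmul : ∀ a b : A, ρ (a * b) = ρ a * ρ b)
    (hρone : ρ 1 = 1)
    -- `C` is a right `H`-module coalgebra:
    (act : C →ₗ[R] H →ₗ[R] C)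
    (hact_mul : ∀ (c : C) (h k : H), act (act c h) k = act c (h * k))
    (hact_one : ∀ c : C, act c 1 = c)
    (hΔ : ∀ (c : C) (h : H),
        Coalgebra.comul (act c h)
          = TensorProduct.map (TensorProduct.lift act) (TensorProduct.lift act)
              (TensorProduct.tensorTensorTensorComm R C C H H
                (Coalgebra.comul c ⊗ₜ[R] Coalgebra.comul h)))
    (hε : ∀ (c : C) (h : H),
        Coalgebra.counit (act c h)
          = Coalgebra.counit (R := R) c * Coalgebra.counit (R := R) h) :
    IsEntwining R A C (doiKoppinenPsi ρ act) ∧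
    -- the Koppinen smash product is associative
    (∀ f g h : C →ₗ[R] A,
        smashMul R (doiKoppinenPsi ρ act) (smashMul R (doiKoppinenPsi ρ act) f g) h
          = smashMul R (doiKoppinenPsi ρ act) f (smashMul R (doiKoppinenPsi ρ act) g h)) ∧
    -- with unit `η_A ∘ ε_C`
    (∀ f : C →ₗ[R] A, smashMul R (doiKoppinenPsi ρ act) (smashOne R) f = f) ∧
    (∀ f : C →ₗ[R] A, smashMul R (doiKoppinenPsi ρ act) f (smashOne R) = f) := by
  have hψ : IsEntwining R A C (doiKoppinenPsi ρ act) :=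
    { mul_compat := by
        ext c a b
        exact doiKoppinenPsi_mul ρ act hρmul hact_mul c a b
      one_compat := fun c => by
        rw [doiKoppinenPsi_tmul, hρone, Algebra.TensorProduct.one_def, TensorProduct.map_tmul,
          hact_one, LinearMap.id_apply]
      comul_compat := by
        ext c a
        exact map_comul_doiKoppinenPsi ρ act hcoassoc hΔ c a
      counit_compat := by
        ext c a
        exact rid_map_counit_doiKoppinenPsi ρ act hcounit hε c a }
  exact ⟨hψ, hψ.smashMul_assoc, hψ.smashOne_smashMul, hψ.smashMul_smashOne⟩
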